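/- arXiv:1303.6127 — 4 statements merged into one kernel-verified Lean document; each statement's English description precedes it below -/
import Mathlib

section
/- The set of times t ∈ [t_0, t_τ] at which the partition of X into ε-connected components is not locally constant is finite and has cardinality at most τ·n·(n−1). (This is the O(τn²) upper bound on the number of vertices of the Reeb graph of the components.) -/
open Set

/-- The plane with the Euclidean metric. -/
abbrev Plane : Type := EuclideanSpace ℝ (Fin 2)

/-- `f` is a piecewise-linear trajectory with breakpoints `t 0, …, t τ`:
it is (the restriction of) an affine map on each interval `[t i, t (i+1)]`. -/
def IsPLTrajectory (τ : ℕ) (t : Fin (τ + 1) → ℝ) (f : ℝ → Plane) : Prop :=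
  ∀ i : Fin τ, ∃ g : ℝ →ᵃ[ℝ] Plane,
    ∀ s ∈ Icc (t i.castSucc) (t i.succ), f s = g s

/-- Entities `x` and `y` are directly connected at time `s`: their `ε`-discs overlap. -/
def DirectlyConnected {n : ℕ} (p : Fin n → ℝ → Plane) (ε s : ℝ) (x y : Fin n) : Prop :=
  dist (p x s) (p y s) ≤ 2 * ε

/-- Entities `x` and `y` are `ε`-connected at time `s`: there is a sequence
`x = x_0, …, x_k = y` of entities with consecutive ones directly connected at `s`. -/
def EpsConnected {n : ℕ} (p : Fin n → ℝ → Plane) (ε s : ℝ) : Fin n → Fin n → Prop :=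
  Relation.ReflTransGen (DirectlyConnected p ε s)

/-- A component at time `s` is a maximal set of pairwise `ε`-connected entities. -/
def IsComponent {n : ℕ} (p : Fin n → ℝ → Plane) (ε s : ℝ) (C : Set (Fin n)) : Prop :=
  (∀ x ∈ C, ∀ y ∈ C, EpsConnected p ε s x y) ∧
  (∀ D : Set (Fin n), C ⊆ D → (∀ x ∈ D, ∀ y ∈ D, EpsConnected p ε s x y) → D = C)
/-- The partition of the entities into components at time `s` (recorded as the
collection of all components at time `s`). -/
def Components {n : ℕ} (p : Fin n → ℝ → Plane) (ε s : ℝ) : Set (Set (Fin n)) :=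
  {C | IsComponent p ε s C}

/-- The partition into components, as a function of time, is locally constant at `s`:
it is constant on some open neighborhood of `s` intersected with `[t0, tτ]`. -/
def PartitionLocallyConstantAt {n : ℕ} (p : Fin n → ℝ → Plane) (ε t0 tτ s : ℝ) : Prop :=
  ∃ U : Set ℝ, IsOpen U ∧ s ∈ U ∧ ∀ u ∈ U ∩ Icc t0 tτ, Components p ε u = Components p ε s

open Polynomial in
theorem aux_poly (ε : ℝ) (hε : 0 ≤ ε) (g h : ℝ →ᵃ[ℝ] Plane) :
    ∃ P : ℝ[X], P.natDegree ≤ 2 ∧ ∀ s, (dist (g s) (h s) ≤ 2 * ε ↔ P.eval s ≤ 0) := by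
  have key : ∀ (g : ℝ →ᵃ[ℝ] Plane) (s : ℝ), g s = g 0 + s • g.linear 1 := by
    intro g s
    have := g.map_vadd 0 s
    simp only [vadd_eq_add, add_zero] at this
    rw [this, ← map_smul]
    simp [add_comm]
  refine ⟨(C (g 0 0 - h 0 0) + C (g.linear 1 0 - h.linear 1 0) * X) ^ 2
    + (C (g 0 1 - h 0 1) + C (g.linear 1 1 - h.linear 1 1) * X) ^ 2 - C (4 * ε ^ 2), ?_, ?_⟩
  · compute_degree
  · intro s
    rw [EuclideanSpace.dist_eq, Real.sqrt_le_left (by positivity), key g s, key h s]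
    simp only [Fin.sum_univ_two, Real.dist_eq, sq_abs, PiLp.add_apply, PiLp.smul_apply,
      smul_eq_mul, eval_add, eval_sub, eval_pow, eval_mul, eval_C, eval_X]
    constructor <;> intro h <;> nlinarith

theorem aux_cover (τ : ℕ) (t : Fin (τ + 2) → ℝ) (ht : StrictMono t) (u : ℝ)
    (h0 : t 0 ≤ u) (h1 : u ≤ t (Fin.last (τ + 1))) :
    ∃ i : Fin (τ + 1), u ∈ Icc (t i.castSucc) (t i.succ) := by
  have : ∀ k : Fin (τ + 2), u ≤ t k → ∃ i : Fin (τ + 1), u ∈ Icc (t i.castSucc) (t i.succ) := by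
    intro k
    induction k using Fin.induction with
    | zero =>
      intro h
      exact ⟨0, h0, h.trans (ht.monotone (Fin.zero_le _))⟩
    | succ i ih =>
      intro h
      by_cases h' : u ≤ t i.castSucc
      · exact ih h'
      · exact ⟨i, (not_le.1 h').le, h⟩
  exact this _ h1

theorem aux_components {n : ℕ} (p : Fin n → ℝ → Plane) (ε : ℝ) (hε : 0 ≤ ε) (s u : ℝ)
    (h : ∀ y x, x < y → (DirectlyConnected p ε u x y ↔ DirectlyConnected p ε s x y)) :
    Components p ε u = Components p ε s := by
  have : DirectlyConnected p ε u = DirectlyConnected p ε s := by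
    funext x y
    apply propext
    rcases lt_trichotomy x y with hxy | rfl | hxy
    · exact h y x hxy
    · simp [DirectlyConnected, hε]
    · have := h x y hxy
      simpa only [DirectlyConnected, dist_comm] using this
  unfold Components IsComponent EpsConnected
  rw [this]

/-- The set of times in `[t 0, t τ]` at which the partition of the entities into
`ε`-connected components is not locally constant is finite, of cardinality at most
`τ · n · (n − 1)`. -/
theorem stmt_2 (n τ : ℕ) (t : Fin (τ + 1) → ℝ) (ht : StrictMono t)
    (ε : ℝ) (hε : 0 ≤ ε) (p : Fin n → ℝ → Plane)
    (hp : ∀ x, IsPLTrajectory τ t (p x)) :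
    {s ∈ Icc (t 0) (t (Fin.last τ)) |
        ¬ PartitionLocallyConstantAt p ε (t 0) (t (Fin.last τ)) s}.Finite ∧
    {s ∈ Icc (t 0) (t (Fin.last τ)) |
        ¬ PartitionLocallyConstantAt p ε (t 0) (t (Fin.last τ)) s}.ncard ≤ τ * n * (n - 1) := by
  classical
  choose g hg using hp
  choose P hdeg hP using fun (i : Fin τ) (x y : Fin n) => aux_poly ε hε (g x i) (g y i)
  have hsub : {s ∈ Icc (t 0) (t (Fin.last τ)) |
        ¬ PartitionLocallyConstantAt p ε (t 0) (t (Fin.last τ)) s} ⊆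
      ((Finset.univ : Finset (Fin τ)).biUnion fun i => (Finset.univ : Finset (Fin n)).biUnion
        fun y => (Finset.Iio y).biUnion fun x => (P i x y).roots.toFinset : Finset ℝ) := by
    rintro s ⟨hs, hnot⟩
    by_contra hcon
    apply hnot
    have hroot : ∀ i y x, x < y → (P i x y).eval s = 0 → P i x y = 0 := by
      intro i y x hxy h0
      by_contra hne
      apply hcon
      simp only [Finset.coe_biUnion, Set.mem_iUnion, Finset.mem_coe]
      refine ⟨i, Finset.mem_univ _, y, Finset.mem_univ _, x, Finset.mem_Iio.2 hxy, ?_⟩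
      rw [Multiset.mem_toFinset, Polynomial.mem_roots hne]
      exact h0
    have e1 : ∀ᶠ u in nhds s, ∀ i y x, x < y →
        ((P i x y).eval u ≤ 0 ↔ (P i x y).eval s ≤ 0) := by
      refine Filter.eventually_all.2 fun i => Filter.eventually_all.2 fun y =>
        Filter.eventually_all.2 fun x => ?_
      by_cases hxy : x < y
      swap
      · exact Filter.Eventually.of_forall fun _ h => absurd h hxy
      suffices hh : ∀ᶠ u in nhds s, ((P i x y).eval u ≤ 0 ↔ (P i x y).eval s ≤ 0) from
        hh.mono fun _ h _ => h
      have hc := (P i x y).continuous.continuousAt (x := s)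
      rcases lt_trichotomy ((P i x y).eval s) 0 with h | h | h
      · filter_upwards [hc.eventually_lt continuousAt_const h] with u hu
        simp [hu.le, h.le]
      · simp [hroot i y x hxy h]
      · filter_upwards [continuousAt_const.eventually_lt hc h] with u hu
        exact iff_of_false (not_le.2 hu) (not_le.2 h)
    have e2 : ∀ᶠ u in nhds s, ∀ i : Fin τ, u ∈ Icc (t i.castSucc) (t i.succ) →
        s ∈ Icc (t i.castSucc) (t i.succ) := by
      rw [Filter.eventually_all]
      intro i
      by_cases h : s ∈ Icc (t i.castSucc) (t i.succ)
      · exact Filter.Eventually.of_forall fun _ _ => h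
      · filter_upwards [isClosed_Icc.isOpen_compl.mem_nhds h] with u hu hu'
        exact absurd hu' hu
    obtain ⟨U, hU, hUo, hsU⟩ := eventually_nhds_iff.1 (e1.and e2)
    refine ⟨U, hUo, hsU, ?_⟩
    rintro u ⟨huU, hu⟩
    obtain ⟨h1, h2⟩ := hU u huU
    rcases τ with _ | τ
    · have hl : t (Fin.last 0) = t 0 := rfl
      rw [hl] at hs hu
      rw [le_antisymm hu.2 hu.1, le_antisymm hs.2 hs.1]
    · obtain ⟨i, hi⟩ := aux_cover τ t ht u hu.1 hu.2
      have hsi := h2 i hi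
      apply aux_components p ε hε
      intro y x hxy
      unfold DirectlyConnected
      rw [hg x i u hi, hg y i u hi, hg x i s hsi, hg y i s hsi, hP, hP]
      exact h1 i y x hxy
  refine ⟨(Finset.finite_toSet _).subset hsub, ?_⟩
  refine (Set.ncard_le_ncard hsub (Finset.finite_toSet _)).trans ?_
  rw [Set.ncard_coe_finset]
  have hc : ∀ i y x, (P i x y).roots.toFinset.card ≤ 2 := fun i y x =>
    (Multiset.toFinset_card_le _).trans ((Polynomial.card_roots' _).trans (hdeg i x y))
  have hi : ∀ i, ((Finset.univ : Finset (Fin n)).biUnion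
        fun y => (Finset.Iio y).biUnion fun x => (P i x y).roots.toFinset).card
          ≤ n * (n - 1) := by
    intro i
    rw [← Finset.sum_range_id_mul_two, Finset.sum_mul,
      ← Fin.sum_univ_eq_sum_range (fun k => k * 2)]
    refine Finset.card_biUnion_le.trans (Finset.sum_le_sum fun y _ => ?_)
    refine (Finset.card_biUnion_le_card_mul _ _ 2 fun x _ => hc i y x).trans ?_
    simp
  refine (Finset.card_biUnion_le_card_mul _ _ _ fun i _ => hi i).trans ?_
  simp [mul_assoc]
end

section
/- There is an absolute constant c > 0 such that for every even n ≥ 2 and every τ ≥ 1 there exist ε ≥ 0 and a set X of n entities, each with a piecewise-linear trajectory of τ edges, for which the partition of X into ε-connected components changes at least c·τ·n² times (i.e., the set of times at which the partition is not locally constant has at least c·τ·n² elements). -/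
open Set

noncomputable section

def zig (s : ℝ) : ℝ := if Even ⌊s⌋ then Int.fract s else 1 - Int.fract s

theorem zig_eq (k : ℕ) (s : ℝ) (h1 : (k : ℝ) ≤ s) (h2 : s ≤ k + 1) :
    zig s = if Even k then s - k else 1 - (s - k) := by
  rcases h2.lt_or_eq with h | h
  · have hf : ⌊s⌋ = (k : ℤ) := by
      rw [Int.floor_eq_iff]; push_cast; exact ⟨h1, h⟩
    simp only [zig, Int.fract, hf, Int.even_coe_nat, Int.cast_natCast]
  · have hf : ⌊s⌋ = (k : ℤ) + 1 := by
      rw [Int.floor_eq_iff]; push_cast; exact ⟨h.ge, by linarith⟩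
    have h3 : Even ((k : ℤ) + 1) ↔ ¬ Even k := by
      rw [Int.even_add_one, Int.even_coe_nat]
    simp only [zig, Int.fract, hf, h3]
    by_cases hk : Even k <;> simp [hk, h]

def traj (m n : ℕ) (x : Fin n) (s : ℝ) : Plane :=
  if (x : ℕ) < m then !₂[(x : ℝ) * m / (m ^ 2 + 1), 0]
  else !₂[zig s - ((x : ℝ) - m + 1) / (m ^ 2 + 1), 0]

theorem traj_pl (m n τ : ℕ) (x : Fin n) :
    IsPLTrajectory τ (fun i => (i : ℕ)) (traj m n x) := by
  intro i
  by_cases hx : (x : ℕ) < m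
  · exact ⟨AffineMap.const ℝ ℝ (!₂[(x : ℝ) * m / (m ^ 2 + 1), 0] : Plane), fun s _ => by
      simp [traj, hx]⟩
  · set b : ℝ := ((x : ℝ) - m + 1) / (m ^ 2 + 1) with hb
    set k : ℕ := (i : Fin τ).val with hk
    refine ⟨AffineMap.lineMap (!₂[(if Even k then -(k : ℝ) else 1 + k) - b, 0] : Plane)
      (!₂[(if Even k then 1 -(k : ℝ) else k) - b, 0] : Plane), fun s hs => ?_⟩
    have hs1 : (k : ℝ) ≤ s := by simpa using hs.1
    have hs2 : s ≤ k + 1 := by simpa using hs.2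
    have := zig_eq k s hs1 hs2
    ext j
    fin_cases j
    · simp only [traj, hx, this, AffineMap.lineMap_apply]
      by_cases he : Even k <;> simp [he] <;> ring
    · simp [traj, hx, AffineMap.lineMap_apply]

theorem conn_symm {n : ℕ} {p : Fin n → ℝ → Plane} {ε s : ℝ} {x y : Fin n}
    (h : EpsConnected p ε s x y) : EpsConnected p ε s y x := by
  induction h with
  | refl => exact Relation.ReflTransGen.refl
  | tail _ hbc ih =>
    refine Relation.ReflTransGen.head ?_ ih
    unfold DirectlyConnected at *
    rwa [dist_comm]

theorem conn_of_components {n : ℕ} {p : Fin n → ℝ → Plane} {ε s u : ℝ} {x y : Fin n}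
    (hc : Components p ε u = Components p ε s)
    (h : EpsConnected p ε s x y) : EpsConnected p ε u x y := by
  have : {z | EpsConnected p ε s x z} ∈ Components p ε s := by
    refine ⟨fun a ha b hb => (conn_symm ha).trans hb, fun D hD hD2 => ?_⟩
    refine Set.Subset.antisymm (fun z hz => ?_) hD
    exact hD2 x (hD Relation.ReflTransGen.refl) z hz
  rw [← hc] at this
  exact this.1 x Relation.ReflTransGen.refl y h

theorem eq_of_conn {n : ℕ} {p : Fin n → ℝ → Plane} {s : ℝ} {x y : Fin n}
    (h : EpsConnected p 0 s x y) : p x s = p y s := by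
  induction h with
  | refl => rfl
  | tail _ hbc ih =>
    rw [ih]
    unfold DirectlyConnected at hbc
    rw [mul_zero] at hbc
    exact dist_le_zero.1 hbc

/-- The collision times. -/
def tm (m : ℕ) (a : ℕ × ℕ) : ℝ := a.1 + ((a.2 : ℝ) + 1) / (m ^ 2 + 1)

theorem frac_mem (m q : ℕ) (hq : q < m ^ 2) :
    0 < ((q : ℝ) + 1) / (m ^ 2 + 1) ∧ ((q : ℝ) + 1) / (m ^ 2 + 1) < 1 := by
  have : (q : ℝ) < m ^ 2 := by exact_mod_cast hq
  refine ⟨by positivity, ?_⟩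
  rw [div_lt_one (by positivity)]
  linarith

theorem tm_inj (m τ : ℕ) :
    Set.InjOn (tm m) (Finset.range τ ×ˢ Finset.range (m ^ 2) : Finset (ℕ × ℕ)) := by
  rintro ⟨k, q⟩ h ⟨k', q'⟩ h' he
  simp only [Finset.coe_product, Finset.coe_range, Set.mem_prod, Set.mem_Iio] at h h'
  obtain ⟨a1, a2⟩ := frac_mem m q h.2
  obtain ⟨b1, b2⟩ := frac_mem m q' h'.2
  simp only [tm] at he
  have e1 : (k : ℝ) < k' + 1 := by linarith
  have e2 : (k' : ℝ) < k + 1 := by linarith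
  have e3 : k < k' + 1 := by exact_mod_cast e1
  have e4 : k' < k + 1 := by exact_mod_cast e2
  have e5 : k = k' := by omega
  subst e5
  have e6 := add_left_cancel he
  rw [div_left_inj' (by positivity)] at e6
  have e7 : (q : ℝ) = q' := by linarith
  rw [Prod.mk.injEq]
  exact ⟨rfl, by exact_mod_cast e7⟩

theorem zig_tm (m k q : ℕ) (hq : q < m ^ 2) :
    ∃ r < m ^ 2, zig (tm m (k, q)) = ((r : ℝ) + 1) / (m ^ 2 + 1) := by
  obtain ⟨a1, a2⟩ := frac_mem m q hq
  rw [zig_eq k _ (by simp only [tm]; linarith) (by simp only [tm]; linarith)]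
  by_cases he : Even k
  · exact ⟨q, hq, by simp [he, tm]⟩
  · refine ⟨m ^ 2 - 1 - q, by omega, ?_⟩
    have : ((m ^ 2 - 1 - q : ℕ) : ℝ) = (m : ℝ) ^ 2 - 1 - q := by
      rw [Nat.sub_sub, Nat.cast_sub (by omega)]; push_cast; ring
    rw [this]
    simp only [he, tm, if_false]
    field_simp
    ring

theorem not_lc (m τ k q : ℕ) (hk : k < τ) (hq : q < m ^ 2) :
    ¬ PartitionLocallyConstantAt (traj m (m + m)) 0 0 τ (tm m (k, q)) := by
  rintro ⟨U, hU, hs, hc⟩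
  obtain ⟨a1, a2⟩ := frac_mem m q hq
  obtain ⟨r, hr, hz⟩ := zig_tm m k q hq
  have hm : 0 < m := by
    rcases Nat.eq_zero_or_pos m with h | h
    · subst h; simp at hq
    · exact h
  set s := tm m (k, q) with hsdef
  have s1 : (k : ℝ) < s := by simp only [hsdef, tm]; linarith
  have s2 : s < k + 1 := by simp only [hsdef, tm]; linarith
  have hi : r / m < m := Nat.div_lt_of_lt_mul (by rw [← sq]; exact hr)
  have hj : r % m < m := Nat.mod_lt _ hm
  set x : Fin (m + m) := ⟨r / m, by omega⟩ with hx
  set y : Fin (m + m) := ⟨m + r % m, by omega⟩ with hy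
  have hrr : ((r / m : ℕ) : ℝ) * m + ((r % m : ℕ) : ℝ) = r := by
    exact_mod_cast Nat.div_add_mod' r m
  have key : ∀ u, traj m (m + m) x u = traj m (m + m) y u ↔ zig u = zig s := by
    intro u
    have hd : (m : ℝ) ^ 2 + 1 ≠ 0 := by positivity
    have hxv : ((x : ℕ) : ℝ) = ((r / m : ℕ) : ℝ) := rfl
    have hyv : ((y : ℕ) : ℝ) = m + ((r % m : ℕ) : ℝ) := by simp only [hy]; push_cast; rfl
    have hx' : (x : ℕ) < m := hi
    have hy' : ¬ (y : ℕ) < m := by simp [hy]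
    have e : zig s = ((r / m : ℕ) : ℝ) * m / (m ^ 2 + 1)
        + (m + ((r % m : ℕ) : ℝ) - m + 1) / (m ^ 2 + 1) := by
      rw [hz, ← hrr]; ring
    simp only [traj, hx', hy', if_true, if_false, hxv, hyv]
    rw [e]
    constructor
    · intro h
      have := congrArg (fun v : Plane => v 0) h
      simp only [PiLp.toLp_apply, Matrix.cons_val_zero] at this
      linarith
    · intro h
      rw [h, add_sub_cancel_right]
  have hconn : EpsConnected (traj m (m + m)) 0 s x y := by
    refine Relation.ReflTransGen.single ?_
    unfold DirectlyConnected
    rw [(key s).2 rfl]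
    simp
  obtain ⟨δ, hδ, hball⟩ := Metric.isOpen_iff.1 hU s hs
  set d := min (δ / 2) ((k + 1 - s) / 2) with hd
  have d0 : 0 < d := lt_min (by linarith) (by linarith)
  have d1 : d ≤ δ / 2 := min_le_left _ _
  have d2 : d ≤ (k + 1 - s) / 2 := min_le_right _ _
  have hkt : (k : ℝ) + 1 ≤ τ := by exact_mod_cast hk
  have hk0 : (0 : ℝ) ≤ k := by positivity
  have hu : s + d ∈ U ∩ Icc (0 : ℝ) τ := by
    refine ⟨hball ?_, by constructor <;> linarith⟩
    rw [Metric.mem_ball, Real.dist_eq, add_sub_cancel_left, abs_of_pos d0]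
    linarith
  have h1 := (key _).1 (eq_of_conn (conn_of_components (hc _ hu) hconn))
  rw [zig_eq k _ (by linarith) (by linarith), zig_eq k s s1.le s2.le] at h1
  split_ifs at h1 <;> linarith

end

/-- Lower bound construction: there is an absolute constant `c > 0` such that for every
even `n ≥ 2` and every `τ ≥ 1` there exist `ε ≥ 0` and `n` entities with
piecewise-linear trajectories of `τ` edges for which the partition into `ε`-connected
components changes at least `c · τ · n²` times: the set of times at which it is not
locally constant has at least `c · τ · n²` elements. -/
theorem stmt_3 :
    ∃ c : ℝ, 0 < c ∧ ∀ n τ : ℕ, Even n → 2 ≤ n → 1 ≤ τ →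
      ∃ (ε : ℝ) (_ : 0 ≤ ε) (t : Fin (τ + 1) → ℝ) (_ : StrictMono t)
        (p : Fin n → ℝ → Plane) (_ : ∀ x, IsPLTrajectory τ t (p x)) (F : Finset ℝ),
        (∀ s ∈ F, s ∈ Icc (t 0) (t (Fin.last τ)) ∧
          ¬ PartitionLocallyConstantAt p ε (t 0) (t (Fin.last τ)) s) ∧
        c * τ * n ^ 2 ≤ F.card := by
  refine ⟨1 / 4, by norm_num, ?_⟩
  rintro n τ ⟨m, rfl⟩ hn hτ
  refine ⟨0, le_rfl, fun i => (i : ℕ), fun a b h => by simpa using h, traj m (m + m),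
    fun x => traj_pl m _ τ x,
    (Finset.range τ ×ˢ Finset.range (m ^ 2)).image (tm m), ?_, ?_⟩
  · intro s hs
    obtain ⟨⟨k, q⟩, ha, rfl⟩ := Finset.mem_image.1 hs
    simp only [Finset.mem_product, Finset.mem_range] at ha
    obtain ⟨a1, a2⟩ := frac_mem m q ha.2
    have hkt : (k : ℝ) + 1 ≤ τ := by exact_mod_cast ha.1
    have hk0 : (0 : ℝ) ≤ k := by positivity
    simp only [Fin.val_zero, Fin.val_last, Nat.cast_zero]
    refine ⟨?_, not_lc m τ k q ha.1 ha.2⟩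
    simp only [tm]
    constructor <;> linarith
  · rw [Finset.card_image_of_injOn (tm_inj m τ)]
    simp only [Finset.card_product, Finset.card_range]
    push_cast
    apply le_of_eq
    ring
end

section
/- Let t_S ≤ t_T ≤ t* be times in [t_0, t_τ]. Suppose S is a group on [t_S, t*], T is a group on [t_T, t*] that is maximal (no group on a larger set or interval covers (T, [t_T, t*]) other than itself), and S ∩ T ≠ ∅. Then S ⊆ T; that is, S is a subgroup of T (S ⊆ T and [t_T, t*] ⊆ [t_S, t*]). -/
open Set

/-- `G` is a group on the interval `[a, b] ⊆ [t0, tτ]` for parameters `ε`, `m`, `δ`: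
it has at least `m` entities, the interval has length at least `δ`, and at every time
`s ∈ [a, b]` all of `G` lies in a single component. -/
def IsGroup {n : ℕ} (p : Fin n → ℝ → Plane) (ε : ℝ) (m : ℕ) (δ t0 tτ : ℝ)
    (G : Finset (Fin n)) (a b : ℝ) : Prop :=
  m ≤ G.card ∧ t0 ≤ a ∧ a ≤ b ∧ b ≤ tτ ∧ δ ≤ b - a ∧
  ∀ s ∈ Icc a b, ∃ C : Set (Fin n), IsComponent p ε s C ∧ ↑G ⊆ C

/-- `G` is a maximal group on `[a, b]`: it is a group on `[a, b]`, and the only group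
`(H, [c, d])` covering `(G, [a, b])` (i.e. with `G ⊆ H` and `[a, b] ⊆ [c, d]`) is
`(G, [a, b])` itself. -/
def IsMaximalGroup {n : ℕ} (p : Fin n → ℝ → Plane) (ε : ℝ) (m : ℕ) (δ t0 tτ : ℝ)
    (G : Finset (Fin n)) (a b : ℝ) : Prop :=
  IsGroup p ε m δ t0 tτ G a b ∧
  ∀ (H : Finset (Fin n)) (c d : ℝ), IsGroup p ε m δ t0 tτ H c d →
    G ⊆ H → c ≤ a → b ≤ d → H = G ∧ c = a ∧ d = b

/-- If `S` is a group on `[t_S, t*]`, `T` is a maximal group on `[t_T, t*]`, where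
`t_S ≤ t_T`, and `S ∩ T ≠ ∅`, then `S ⊆ T`; that is, `S` is a subgroup of `T`
(`S ⊆ T` and `[t_T, t*] ⊆ [t_S, t*]`). -/
theorem stmt_7 (n τ : ℕ) (t : Fin (τ + 1) → ℝ) (ht : StrictMono t)
    (ε : ℝ) (hε : 0 ≤ ε) (m : ℕ) (hm : 1 ≤ m) (δ : ℝ) (hδ : 0 ≤ δ)
    (p : Fin n → ℝ → Plane) (hp : ∀ x, IsPLTrajectory τ t (p x))
    (S T : Finset (Fin n)) (tS tT tstar : ℝ) (hts : tS ≤ tT)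
    (hS : IsGroup p ε m δ (t 0) (t (Fin.last τ)) S tS tstar)
    (hT : IsMaximalGroup p ε m δ (t 0) (t (Fin.last τ)) T tT tstar)
    (hinter : (S ∩ T).Nonempty) :
    S ⊆ T := by
  obtain ⟨x, hx⟩ := hinter
  rw [Finset.mem_inter] at hx
  obtain ⟨⟨hTm, hT0, hTab, hTτ, hTδ, hTc⟩, hmax⟩ := hT
  obtain ⟨_, _, _, _, _, hSc⟩ := hS
  have hG : IsGroup p ε m δ (t 0) (t (Fin.last τ)) (S ∪ T) tT tstar := by
    refine ⟨hTm.trans (Finset.card_le_card Finset.subset_union_right),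
      hT0, hTab, hTτ, hTδ, ?_⟩
    intro s hs
    obtain ⟨C, hC, hSC⟩ := hSc s ⟨hts.trans hs.1, hs.2⟩
    obtain ⟨D, hD, hTD⟩ := hTc s hs
    have hxC : x ∈ C := hSC (Finset.mem_coe.2 hx.1)
    have hxD : x ∈ D := hTD (Finset.mem_coe.2 hx.2)
    have key : ∀ y ∈ C ∪ D, EpsConnected p ε s x y ∧ EpsConnected p ε s y x := by
      rintro y (hy | hy)
      · exact ⟨hC.1 x hxC y hy, hC.1 y hy x hxC⟩
      · exact ⟨hD.1 x hxD y hy, hD.1 y hy x hxD⟩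
    have hU : C ∪ D = D := hD.2 (C ∪ D) Set.subset_union_right
      (fun y hy z hz => Relation.ReflTransGen.trans (key y hy).2 (key z hz).1)
    refine ⟨D, hD, ?_⟩
    rw [Finset.coe_union]
    exact Set.union_subset (hSC.trans (Set.union_eq_right.1 hU)) hTD
  have h := (hmax (S ∪ T) tT tstar hG Finset.subset_union_right le_rfl le_rfl).1
  exact Finset.union_eq_right.1 h
end

section
/- Let P be a nonempty finite set of points in ℝ² and let ε > 0. The union of the closed discs of radius ε centered at the points of P is a connected subset of ℝ² if and only if for every p, q ∈ P there is a finite sequence p = p_0, p_1, …, p_k = q of points of P with dist(p_i, p_{i+1}) ≤ 2ε for all i. (Thus a set of entities is ε-connected at time t exactly when the union of their ε-discs forms a single connected region.) -/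
open Set

/-- For a nonempty finite set `P` of points in the plane and `ε > 0`, the union of the
closed `ε`-discs centered at the points of `P` is connected if and only if any two
points of `P` are joined by a finite sequence of points of `P` in which consecutive
points are at distance at most `2ε`. -/
theorem stmt_15 (P : Finset (EuclideanSpace ℝ (Fin 2))) (hP : P.Nonempty)
    (ε : ℝ) (hε : 0 < ε) :
    IsConnected (⋃ p ∈ P, Metric.closedBall p ε) ↔
      ∀ p ∈ P, ∀ q ∈ P,
        Relation.ReflTransGen
          (fun a b => a ∈ P ∧ b ∈ P ∧ dist a b ≤ 2 * ε) p q := by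
  constructor
  · intro h p hp q hq
    by_contra hpq
    let R := fun a b : EuclideanSpace ℝ (Fin 2) => a ∈ P ∧ b ∈ P ∧ dist a b ≤ 2 * ε
    let S : Set (EuclideanSpace ℝ (Fin 2)) := {x | x ∈ P ∧ Relation.ReflTransGen R p x}
    let T : Set (EuclideanSpace ℝ (Fin 2)) := {x | x ∈ P ∧ ¬ Relation.ReflTransGen R p x}
    have hS : S.Finite := P.finite_toSet.subset fun x hx => hx.1
    have hT : T.Finite := P.finite_toSet.subset fun x hx => hx.1
    have hcS : IsClosed (⋃ x ∈ S, Metric.closedBall x ε) :=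
      hS.isClosed_biUnion fun x _ => Metric.isClosed_closedBall
    have hcT : IsClosed (⋃ x ∈ T, Metric.closedBall x ε) :=
      hT.isClosed_biUnion fun x _ => Metric.isClosed_closedBall
    have key := isPreconnected_closed_iff.1 h.isPreconnected _ _ hcS hcT (by
      intro y hy
      simp only [mem_iUnion, exists_prop] at hy
      obtain ⟨x, hx, hyx⟩ := hy
      by_cases hr : Relation.ReflTransGen R p x
      · exact Or.inl (mem_biUnion (show x ∈ S from ⟨hx, hr⟩) hyx)
      · exact Or.inr (mem_biUnion (show x ∈ T from ⟨hx, hr⟩) hyx))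
      ⟨p, mem_biUnion (show p ∈ (P : Set _) from hp) (Metric.mem_closedBall_self hε.le),
        mem_biUnion (show p ∈ S from ⟨hp, .refl⟩) (Metric.mem_closedBall_self hε.le)⟩
      ⟨q, mem_biUnion (show q ∈ (P : Set _) from hq) (Metric.mem_closedBall_self hε.le),
        mem_biUnion (show q ∈ T from ⟨hq, hpq⟩) (Metric.mem_closedBall_self hε.le)⟩
    obtain ⟨y, -, hy1, hy2⟩ := key
    simp only [mem_iUnion, exists_prop] at hy1 hy2
    obtain ⟨a, ha, hya⟩ := hy1
    obtain ⟨b, hb, hyb⟩ := hy2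
    rw [Metric.mem_closedBall] at hya hyb
    have := dist_triangle_left a b y
    exact hb.2 (ha.2.tail ⟨ha.1, hb.1, by linarith⟩)
  · intro h
    refine IsConnected.biUnion_of_reflTransGen (t := (P : Set (EuclideanSpace ℝ (Fin 2)))) hP (fun i _ => ?_) ?_
    · exact ⟨⟨i, Metric.mem_closedBall_self hε.le⟩,
        (convex_closedBall i ε).isPreconnected⟩
    · intro i hi j hj
      refine Relation.ReflTransGen.mono ?_ _ _ (h i hi j hj)
      rintro a b ⟨ha, -, hab⟩
      refine ⟨⟨midpoint ℝ a b, ?_, ?_⟩, ha⟩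
      · rw [Metric.mem_closedBall, dist_midpoint_left, Real.norm_ofNat]
        linarith
      · rw [Metric.mem_closedBall, dist_midpoint_right, Real.norm_ofNat]
        linarith
end
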